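/- The identity γ₁⁺𝒟⁻ = γ₁⁻𝒟⁺ holds; that is, the two possible definitions of the hypersingular operator H = −γ₁⁺𝒟⁻ = −γ₁⁻𝒟⁺ coincide. -/

import Mathlib

open Matrix BigOperators

noncomputable section

variable {V : Type*} [Fintype V] [DecidableEq V]

/-- Weighted graph Laplacian of a symmetric weight function. -/
def lap (σ : V → V → ℝ) : Matrix V V ℝ :=
  Matrix.of fun x y => if x = y then ∑ z, σ x z else -σ x y

/-- Restriction matrix `R_X : ℝ^V → ℝ^X`. -/
def restr (X : Finset V) : Matrix {x // x ∈ X} V ℝ :=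
  Matrix.of fun i j => if (i : V) = j then 1 else 0

/-- Green function `G = R_{V°}ᵀ (L[V°,V°])⁻¹ R_{V°}` with `V° = Bᶜ`. -/
def green (B : Finset V) (σ : V → V → ℝ) : Matrix V V ℝ :=
  (restr Bᶜ)ᵀ * (restr Bᶜ * lap σ * (restr Bᶜ)ᵀ)⁻¹ * restr Bᶜ

/-- Dirichlet trace operator `γ₀ = R_{∂Ω}`. -/
def gamma0 (dO : Finset V) : Matrix {x // x ∈ dO} V ℝ := restr dO

/-- Exterior Neumann trace operator `γ₁⁺ = -R_{∂Ω} L(σ⁺)`. -/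
def gamma1p (dO : Finset V) (σp : V → V → ℝ) : Matrix {x // x ∈ dO} V ℝ :=
  -(restr dO * lap σp)

/-- Interior Neumann trace operator `γ₁⁻ = R_{∂Ω} L(σ⁻)`. -/
def gamma1m (dO : Finset V) (σm : V → V → ℝ) : Matrix {x // x ∈ dO} V ℝ :=
  restr dO * lap σm

/-- Single layer potential `𝒮 = G γ₀ᵀ`. -/
def slp (B dO : Finset V) (σ : V → V → ℝ) : Matrix V {x // x ∈ dO} ℝ :=
  green B σ * (gamma0 dO)ᵀ

/-- Exterior double layer potential `𝒟⁺ = G (γ₁⁺)ᵀ`. -/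
def dlpP (B dO : Finset V) (σ σp : V → V → ℝ) : Matrix V {x // x ∈ dO} ℝ :=
  green B σ * (gamma1p dO σp)ᵀ

/-- Interior double layer potential `𝒟⁻ = G (γ₁⁻)ᵀ`. -/
def dlpM (B dO : Finset V) (σ σm : V → V → ℝ) : Matrix V {x // x ∈ dO} ℝ :=
  green B σ * (gamma1m dO σm)ᵀ

/-- Single layer boundary operator `S = γ₀ 𝒮`. -/
def Sop (B dO : Finset V) (σ : V → V → ℝ) : Matrix {x // x ∈ dO} {x // x ∈ dO} ℝ :=
  gamma0 dO * slp B dO σ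

/-- Double layer boundary operator `D = ½ γ₀ (𝒟⁺ + 𝒟⁻)`. -/
def Dop (B dO : Finset V) (σ σp σm : V → V → ℝ) : Matrix {x // x ∈ dO} {x // x ∈ dO} ℝ :=
  (1/2 : ℝ) • (gamma0 dO * (dlpP B dO σ σp + dlpM B dO σ σm))

/-- Adjoint double layer (Neumann–Poincaré) operator `D' = ½ (γ₁⁺ + γ₁⁻) 𝒮`. -/
def Dadj (B dO : Finset V) (σ σp σm : V → V → ℝ) : Matrix {x // x ∈ dO} {x // x ∈ dO} ℝ :=
  (1/2 : ℝ) • ((gamma1p dO σp + gamma1m dO σm) * slp B dO σ)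

/-- Hypersingular operator `H = -γ₁⁺ 𝒟⁻`. -/
def Hop (B dO : Finset V) (σ σp σm : V → V → ℝ) : Matrix {x // x ∈ dO} {x // x ∈ dO} ℝ :=
  -(gamma1p dO σp * dlpM B dO σ σm)

/-- Indicator vector of a node subset. -/
def ind (X : Finset V) : V → ℝ := fun x => if x ∈ X then 1 else 0

/-- The subgraph with node set `A` and edges `{x,y}` with `w x y > 0` is connected. -/
def connOn (A : Finset V) (w : V → V → ℝ) : Prop :=
  ∀ x ∈ A, ∀ y ∈ A, Relation.ReflTransGen (fun a b => a ∈ A ∧ b ∈ A ∧ 0 < w a b) x y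

lemma lap_transpose {V : Type*} [Fintype V] [DecidableEq V] {σ : V → V → ℝ}
    (hσ : ∀ x y, σ x y = σ y x) : (lap σ)ᵀ = lap σ := by
  ext x y
  by_cases h : x = y
  · simp [h]
  · simp [lap, h, Ne.symm h, hσ x y]

lemma lap_add {V : Type*} [Fintype V] [DecidableEq V] (σ τ : V → V → ℝ) :
    lap σ + lap τ = lap (fun x y => σ x y + τ x y) := by
  ext x y
  by_cases h : x = y
  · simp [lap, h, Finset.sum_add_distrib]
  · simp [lap, h, add_comm]

/-- Restricting to `Y` after extending by zero from `X ⊇ Y` recovers the restriction to `Y`. -/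
lemma restr_mul_restr_transpose_mul_restr {V : Type*} [Fintype V] [DecidableEq V]
    {X Y : Finset V} (h : Y ⊆ X) : restr Y * ((restr X)ᵀ * restr X) = restr Y := by
  have hdiag : (restr X)ᵀ * restr X = diagonal (ind X) := by
    ext x y
    simp only [mul_apply, transpose_apply, restr, of_apply, diagonal_apply, ind]
    rw [Finset.sum_coe_sort X (fun i => (if i = x then (1 : ℝ) else 0) * if i = y then 1 else 0)]
    by_cases hxy : x = y <;> simp [hxy, eq_comm (a := y)]
  rw [hdiag]
  ext i y
  by_cases hy : (i : V) = y
  · simp [restr, ind, ← hy, h i.2]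
  · simp [restr, hy]

lemma green_transpose {V : Type*} [Fintype V] [DecidableEq V] (B : Finset V) {σ : V → V → ℝ}
    (hσ : ∀ x y, σ x y = σ y x) : (green B σ)ᵀ = green B σ := by
  simp [green, transpose_nonsing_inv, lap_transpose hσ, Matrix.mul_assoc]

/-- The Green function inverts the Laplacian on rows away from `B`. -/
lemma restr_mul_lap_mul_green {V : Type*} [Fintype V] [DecidableEq V] {B Y : Finset V}
    (h : Y ⊆ Bᶜ) {σ : V → V → ℝ}
    (hdet : IsUnit (restr Bᶜ * lap σ * (restr Bᶜ)ᵀ).det) :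
    restr Y * lap σ * green B σ = restr Y := by
  have hinv : restr Bᶜ * lap σ * green B σ = restr Bᶜ := by
    rw [green, ← Matrix.mul_assoc, ← Matrix.mul_assoc, mul_nonsing_inv _ hdet, Matrix.one_mul]
  calc restr Y * lap σ * green B σ
      = restr Y * (restr Bᶜ)ᵀ * (restr Bᶜ * lap σ * green B σ) := by
        nth_rewrite 1 [← restr_mul_restr_transpose_mul_restr h]
        simp only [Matrix.mul_assoc]
    _ = restr Y := by
        rw [hinv, Matrix.mul_assoc, restr_mul_restr_transpose_mul_restr h]

theorem stmt_7
    {V : Type*} [Fintype V] [DecidableEq V]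
    (B Op dO Om : Finset V)
    (hBne : B.Nonempty) (hOpne : Op.Nonempty) (hdOne : dO.Nonempty) (hOmne : Om.Nonempty)
    (hd1 : Disjoint B Op) (hd2 : Disjoint B dO) (hd3 : Disjoint B Om)
    (hd4 : Disjoint Op dO) (hd5 : Disjoint Op Om) (hd6 : Disjoint dO Om)
    (hcover : B ∪ Op ∪ dO ∪ Om = Finset.univ)
    (σ σp σm : V → V → ℝ)
    (hσsymm : ∀ x y, σ x y = σ y x) (hσdiag : ∀ x, σ x x = 0)
    (hσnn : ∀ x y, 0 ≤ σ x y)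
    (hsepBdO : ∀ x ∈ B, ∀ y ∈ dO, σ x y = 0)
    (hsepBOm : ∀ x ∈ B, ∀ y ∈ Om, σ x y = 0)
    (hsepOpOm : ∀ x ∈ Op, ∀ y ∈ Om, σ x y = 0)
    (hσpsymm : ∀ x y, σp x y = σp y x) (hσpdiag : ∀ x, σp x x = 0)
    (hσmsymm : ∀ x y, σm x y = σm y x) (hσmdiag : ∀ x, σm x x = 0)
    (hσpnn : ∀ x y, 0 ≤ σp x y) (hσmnn : ∀ x y, 0 ≤ σm x y)
    (hsum : ∀ x y, σp x y + σm x y = σ x y)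
    (hp1 : ∀ x y, x ∈ B ∪ Op ∨ y ∈ B ∪ Op → σp x y = σ x y)
    (hm1 : ∀ x y, x ∈ Om ∨ y ∈ Om → σm x y = σ x y)
    (hpd : (restr Bᶜ * lap σ * (restr Bᶜ)ᵀ).PosDef) :
    gamma1p dO σp * dlpM B dO σ σm = gamma1m dO σm * dlpP B dO σ σp := by
  have hsplit : lap σ = lap σp + lap σm := by
    rw [lap_add]; simp only [hsum]
  have hdO : dO ⊆ Bᶜ := fun x hx => Finset.mem_compl.2 (Finset.disjoint_right.1 hd2 hx)
  have hleft : restr dO * lap σp * green B σ = restr dO - restr dO * lap σm * green B σ := by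
    rw [eq_sub_iff_add_eq, ← Matrix.add_mul, ← Matrix.mul_add, ← hsplit]
    exact restr_mul_lap_mul_green hdO ((isUnit_iff_isUnit_det _).1 hpd.isUnit)
  have hright : green B σ * (restr dO * lap σp)ᵀ
      = (restr dO)ᵀ - green B σ * (restr dO * lap σm)ᵀ := by
    simpa only [transpose_mul, transpose_sub, green_transpose B hσsymm] using
      congrArg transpose hleft
  have hsymm : restr dO * (restr dO * lap σm)ᵀ = restr dO * lap σm * (restr dO)ᵀ := by
    rw [transpose_mul, lap_transpose hσmsymm, Matrix.mul_assoc]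
  rw [gamma1p, dlpM, gamma1m, dlpP, gamma1p, transpose_neg, Matrix.mul_neg, hright,
    Matrix.neg_mul, ← Matrix.mul_assoc, hleft, Matrix.mul_neg, Matrix.sub_mul, Matrix.mul_sub,
    hsymm, ← Matrix.mul_assoc]
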